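/- Let n be a nonnegative integer and let a, c ∈ ℂ satisfy c + j ≠ 0 for 0 ≤ j ≤ n−1, 1−c−n+j ≠ 0 for 0 ≤ j ≤ ⌊n/2⌋, and c−a+n+j ≠ 0 for 0 ≤ j ≤ ⌊n/2⌋. Then (c−a)_n/(c)_n = Σ_{k=0}^{⌊n/2⌋} C(n,2k) (−1)^k (c−a+3k) (1−a)_{2k} (c−a)_k / ((1−c−n)_k (c−a+n)_{k+1} (c)_k) − Σ_{0 ≤ 2k+1 ≤ n} C(n,2k+1) (−1)^k (c+k) (1−a)_{2k+1} (c−a)_{k+1} / ((1−c−n)_{k+1} (c−a+n)_{k+1} (c)_{k+1}). (Fourth-type reciprocal relation dual to the Chu–Vandermonde–Gauß summation formula, second form.) -/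

import Mathlib

/-- Rising factorial (Pochhammer symbol) of a complex number:
`poch x 0 = 1` and `poch x (m+1) = poch x m * (x + m)`. -/
noncomputable def poch (x : ℂ) : ℕ → ℂ
  | 0 => 1
  | m + 1 => poch x m * (x + (m : ℂ))

theorem poch_zero (x : ℂ) : poch x 0 = 1 := rfl
theorem poch_succ (x : ℂ) (m : ℕ) : poch x (m + 1) = poch x m * (x + (m : ℂ)) := rfl

theorem poch_add (x : ℂ) (m k : ℕ) : poch x (m + k) = poch x m * poch (x + m) k := by
  induction k with
  | zero => simp [poch_zero]
  | succ k ih =>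
    rw [← add_assoc, poch_succ, ih, poch_succ]; push_cast; ring

theorem poch_succ_left (x : ℂ) (m : ℕ) : poch x (m + 1) = x * poch (x + 1) m := by
  rw [add_comm, poch_add]; simp [poch_succ, poch_zero]

theorem poch_ne_zero (x : ℂ) (m : ℕ) (h : ∀ j : ℕ, j < m → x + (j : ℂ) ≠ 0) :
    poch x m ≠ 0 := by
  induction m with
  | zero => simp [poch_zero]
  | succ k ih =>
    rw [poch_succ]
    exact mul_ne_zero (ih fun j hj => h j (by omega)) (h k (by omega))

theorem poch_reflect (y : ℂ) (k : ℕ) : poch (1 - y) k = (-1) ^ k * poch (y - k) k := by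
  induction k with
  | zero => simp [poch_zero]
  | succ k ih =>
    rw [poch_succ, ih, poch_succ_left]
    push_cast
    rw [show y - (k + 1) + 1 = y - (k : ℂ) by ring]
    ring

theorem poch_continuous (m : ℕ) : Continuous fun x : ℂ => poch x m := by
  induction m with
  | zero => simpa [poch_zero] using continuous_const
  | succ k ih =>
    simp only [poch_succ]
    fun_prop

noncomputable def tE (b x : ℂ) (n k : ℕ) : ℂ :=
  (n.choose (2 * k) : ℂ) * (b + 3 * k) * poch x (2 * k) * poch (b + 1 - x + k) (n - 2 * k) /
    poch (b + k) (n + 1)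

noncomputable def tO (b x : ℂ) (n k : ℕ) : ℂ :=
  (n.choose (2 * k + 1) : ℂ) * poch x (2 * k + 1) * poch (b + 1 - x + k) (n - (2 * k + 1)) /
    poch (b + k + 1) n

noncomputable def gO (b x : ℂ) (n k : ℕ) : ℂ :=
  -(n.choose (2 * k) : ℂ) * poch x (2 * k + 1) * poch (b + 1 - x + k) (n - 2 * k) /
    poch (b + k + 1) (n + 1)

noncomputable def gE (b x : ℂ) (n : ℕ) : ℕ → ℂ
  | 0 => 0
  | k + 1 => -(n.choose (2 * k + 1) : ℂ) * poch x (2 * k + 2) *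
      poch (b + 1 - x + k) (n - (2 * k + 1)) / poch (b + k + 1) (n + 1)

theorem choose_rel (n m : ℕ) (h : m ≤ n) :
    (n.choose (m + 1) : ℂ) = n.choose m * (n - m) / (m + 1) := by
  have h1 := Nat.choose_succ_right_eq n m
  have h2 : ((n.choose (m+1) * (m+1) : ℕ) : ℂ) = ((n.choose m * (n - m) : ℕ) : ℂ) := by rw [h1]
  push_cast [Nat.cast_sub h] at h2
  have : (m : ℂ) + 1 ≠ 0 := by exact_mod_cast Nat.succ_ne_zero m
  field_simp
  exact h2

theorem stepB (b x : ℂ) (hb : ∀ j : ℕ, b + (j : ℂ) ≠ 0) (n k : ℕ) :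
    tO b x (n + 1) k - tO b x n k + gO b x n k = gE b x n (k + 1) := by
  have hk : ∀ j, poch (b + k + 1) j ≠ 0 := fun j => poch_ne_zero _ _ fun i _ => by
    have := hb (k + 1 + i); push_cast at this
    rwa [show b + k + 1 + (i : ℂ) = b + (k + 1 + i) by ring]
  have hn : b + k + 1 + (n : ℂ) ≠ 0 := by
    have := hb (k + 1 + n); push_cast at this
    rwa [show b + k + 1 + (n : ℂ) = b + (k + 1 + n) by ring]
  simp only [tO, gO, gE]
  rcases lt_trichotomy n (2 * k) with h | h | h
  · rw [Nat.choose_eq_zero_of_lt (show n + 1 < 2 * k + 1 by omega),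
      Nat.choose_eq_zero_of_lt (show n < 2 * k + 1 by omega),
      Nat.choose_eq_zero_of_lt (show n < 2 * k by omega)]
    simp
  · subst h
    simp
    ring
  · obtain ⟨j, rfl⟩ : ∃ j, n = 2 * k + 1 + j := ⟨n - (2 * k + 1), by omega⟩
    rw [show 2 * k + 1 + j + 1 - (2 * k + 1) = j + 1 by omega,
      show 2 * k + 1 + j - (2 * k + 1) = j by omega,
      show 2 * k + 1 + j - 2 * k = j + 1 by omega]
    rw [show 2 * k + 2 = 2 * k + 1 + 1 by ring, poch_succ _ j, poch_succ _ (2 * k + 1 + j),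
      poch_succ x (2 * k + 1), Nat.choose_succ_succ (2 * k + 1 + j) (2 * k)]
    simp only [Nat.succ_eq_add_one]
    push_cast
    rw [choose_rel _ (2 * k) (by omega)]
    have h1 := hk (2 * k + 1 + j)
    have h2 : ((2 * k : ℕ) : ℂ) + 1 ≠ 0 := by exact_mod_cast Nat.succ_ne_zero (2 * k)
    push_cast at h1 h2 hn ⊢
    field_simp
    ring

theorem stepA (b x : ℂ) (hb : ∀ j : ℕ, b + (j : ℂ) ≠ 0) (n k : ℕ) :
    tE b x (n + 1) k - tE b x n k + gE b x n k = gO b x n k := by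
  have hk : ∀ i j : ℕ, poch (b + i) j ≠ 0 := fun i j => poch_ne_zero _ _ fun l _ => by
    have := hb (i + l); push_cast at this
    rwa [add_assoc]
  have hk' : ∀ i j : ℕ, poch (b + i + 1) j ≠ 0 := fun i j => by
    have := hk (i + 1) j; push_cast at this
    rwa [add_assoc]
  have hn : b + k + 1 + (n : ℂ) ≠ 0 := by
    have := hb (k + 1 + n); push_cast at this
    rwa [show b + k + 1 + (n : ℂ) = b + (k + 1 + n) by ring]
  have hbk := hb k
  have h1 := hk' k n
  cases k with
  | zero =>
    simp only [tE, gO, gE]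
    simp only [mul_zero, Nat.choose_zero_right, Nat.sub_zero]
    rw [poch_succ_left (b + (0 : ℕ)), poch_succ_left (b + (0 : ℕ)) n, poch_succ _ n, poch_succ _ n]
    simp only [poch_zero, poch_succ]
    push_cast at *
    field_simp
    ring
  | succ k =>
    simp only [tE, gO, gE]
    rcases lt_trichotomy n (2 * k + 1) with h | h | h
    · rw [Nat.choose_eq_zero_of_lt (show n + 1 < 2 * (k + 1) by omega),
        Nat.choose_eq_zero_of_lt (show n < 2 * (k + 1) by omega),
        Nat.choose_eq_zero_of_lt (show n < 2 * k + 1 by omega)]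
      simp
    · subst h
      rw [show 2 * (k + 1) = 2 * k + 1 + 1 by ring, Nat.choose_self, Nat.choose_self,
        Nat.choose_succ_self, Nat.sub_self, Nat.sub_self]
      rw [show b + ((k + 1 : ℕ) : ℂ) + 1 = b + k + 1 + 1 by push_cast; ring] at *
      rw [show b + ((k + 1 : ℕ) : ℂ) = b + k + 1 by push_cast; ring] at *
      rw [poch_succ_left (b + k + 1) (2 * k + 1 + 1), poch_succ_left (b + k + 1) (2 * k + 1),
        poch_succ (b + k + 1 + 1)]
      simp only [poch_zero]
      push_cast at *
      obtain ⟨d, hd⟩ : ∃ d : ℂ, d = b + k + 1 + 1 + (2 * k + 1) := ⟨_, rfl⟩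
      rw [← hd] at hn ⊢
      field_simp
      rw [hd]
      ring
    · obtain ⟨j, rfl⟩ : ∃ j, n = 2 * k + 2 + j := ⟨n - (2 * k + 2), by omega⟩
      rw [show 2 * (k + 1) = 2 * k + 1 + 1 by ring,
        show 2 * k + 2 + j + 1 - (2 * k + 1 + 1) = j + 1 by omega,
        show 2 * k + 2 + j - (2 * k + 1 + 1) = j by omega,
        show 2 * k + 2 + j - (2 * k + 1) = j + 1 by omega,
        poch_succ_left (b + 1 - x + (k : ℂ)),
        Nat.choose_succ_succ (2 * k + 2 + j) (2 * k + 1)]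
      simp only [Nat.succ_eq_add_one]
      rw [show b + ((k + 1 : ℕ) : ℂ) + 1 = b + k + 1 + 1 by push_cast; ring] at *
      rw [show b + ((k + 1 : ℕ) : ℂ) = b + k + 1 by push_cast; ring] at *
      rw [show b + 1 - x + ((k + 1 : ℕ) : ℂ) = b + 1 - x + k + 1 by push_cast; ring] at *
      rw [poch_succ_left (b + k + 1) (2 * k + 2 + j + 1), poch_succ_left (b + k + 1) (2 * k + 2 + j),
        poch_succ (b + k + 1 + 1),
        poch_succ (b + 1 - x + k + 1), poch_succ x (2 * k + 1 + 1)]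
      push_cast
      rw [choose_rel _ (2 * k + 1) (by omega)]
      have h2 : ((2 * k + 1 : ℕ) : ℂ) + 1 ≠ 0 := by exact_mod_cast Nat.succ_ne_zero (2 * k + 1)
      push_cast at *
      obtain ⟨d, hd⟩ : ∃ d : ℂ, d = b + k + 1 + 1 + (2 * k + 2 + j) := ⟨_, rfl⟩
      rw [← hd] at hn ⊢
      field_simp
      rw [hd]
      ring

theorem partial_sum (b x : ℂ) (hb : ∀ j : ℕ, b + (j : ℂ) ≠ 0) (n K : ℕ) :
    (∑ k ∈ Finset.range K, (tE b x (n + 1) k + tO b x (n + 1) k)) -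
      ∑ k ∈ Finset.range K, (tE b x n k + tO b x n k) = gE b x n K := by
  induction K with
  | zero => simp [gE]
  | succ K ih =>
    rw [Finset.sum_range_succ, Finset.sum_range_succ]
    linear_combination ih + stepA b x hb n K + stepB b x hb n K

theorem total_sum (b x : ℂ) (hb : ∀ j : ℕ, b + (j : ℂ) ≠ 0) (K n : ℕ) (h : n < 2 * (K + 1)) :
    ∑ k ∈ Finset.range (K + 1), (tE b x n k + tO b x n k) = 1 := by
  induction n with
  | zero =>
    rw [Finset.sum_eq_single 0]
    · have := hb 0
      simp [tE, tO, poch_zero, poch_succ] at *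
      exact this
    · intro k _ hk
      obtain ⟨k, rfl⟩ := Nat.exists_eq_succ_of_ne_zero hk
      simp [tE, tO, mul_add]
    · simp
  | succ n ih =>
    have h1 := partial_sum b x hb n (K + 1)
    rw [ih (by omega)] at h1
    simp only [gE] at h1
    rw [Nat.choose_eq_zero_of_lt (show n < 2 * K + 1 by omega)] at h1
    simp at h1
    linear_combination h1

theorem generic_case (n : ℕ) (a c : ℂ)
    (hc : ∀ j : ℕ, j < n → c + (j : ℂ) ≠ 0)
    (hb : ∀ j : ℕ, c - a + (j : ℂ) ≠ 0) :
    poch (c - a) n / poch c n =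
      (∑ k ∈ Finset.range (n / 2 + 1),
        (n.choose (2 * k) : ℂ) *
          ((-1 : ℂ) ^ k * (c - a + 3 * (k : ℂ)) * poch (1 - a) (2 * k) * poch (c - a) k) /
          (poch (1 - c - (n : ℂ)) k * poch (c - a + (n : ℂ)) (k + 1) * poch c k)) -
      ∑ k ∈ Finset.range ((n + 1) / 2),
        (n.choose (2 * k + 1) : ℂ) *
          ((-1 : ℂ) ^ k * (c + (k : ℂ)) * poch (1 - a) (2 * k + 1) * poch (c - a) (k + 1)) /
          (poch (1 - c - (n : ℂ)) (k + 1) * poch (c - a + (n : ℂ)) (k + 1) *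
            poch c (k + 1)) := by
  have hk : ∀ i j : ℕ, poch (c - a + i) j ≠ 0 := fun i j => poch_ne_zero _ _ fun l _ => by
    have := hb (i + l); push_cast at this
    rwa [add_assoc]
  have hk0 : ∀ j : ℕ, poch (c - a) j ≠ 0 := fun j => poch_ne_zero _ _ fun l _ => hb l
  have hcn0 : poch c n ≠ 0 := poch_ne_zero _ _ hc
  have hE : ∀ k ∈ Finset.range (n / 2 + 1),
      (n.choose (2 * k) : ℂ) *
          ((-1 : ℂ) ^ k * (c - a + 3 * (k : ℂ)) * poch (1 - a) (2 * k) * poch (c - a) k) /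
          (poch (1 - c - (n : ℂ)) k * poch (c - a + (n : ℂ)) (k + 1) * poch c k) =
      poch (c - a) n / poch c n * tE (c - a) (1 - a) n k := by
    intro k hkr
    rw [Finset.mem_range] at hkr
    obtain ⟨j, hj⟩ : ∃ j, n = k + j + k := ⟨n - 2 * k, by omega⟩
    have e1 : poch (1 - c - (n : ℂ)) k = (-1) ^ k * poch (c + (k + j : ℕ)) k := by
      rw [sub_sub, poch_reflect, hj]; push_cast
      rw [show c + (k + j + k) - (k : ℂ) = c + (k + j) by ring]
    have e2 : poch c n = poch c k * poch (c + k) j * poch (c + (k + j : ℕ)) k := by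
      rw [hj, poch_add, poch_add]
    have e3 : poch (c - a) k * poch (c - a + k) (n + 1) =
        poch (c - a) n * poch (c - a + n) (k + 1) := by
      rw [← poch_add, ← poch_add]; congr 1; omega
    rw [e2] at hcn0
    have n1 := left_ne_zero_of_mul (left_ne_zero_of_mul hcn0)
    have n2 := right_ne_zero_of_mul (left_ne_zero_of_mul hcn0)
    have n3 := right_ne_zero_of_mul hcn0
    have n4 := hk k (n + 1)
    have n5 := hk n (k + 1)
    unfold tE
    rw [e1, e2, show n - 2 * k = j by omega, show c - a + 1 - (1 - a) + (k : ℂ) = c + k by ring]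
    have n6 : ((-1 : ℂ)) ^ k ≠ 0 := by simp
    have e3' : poch (c - a) k = poch (c - a) n * poch (c - a + n) (k + 1) /
      poch (c - a + k) (n + 1) := by rw [← e3]; field_simp
    rw [e3']
    generalize poch (c - a + n) (k + 1) = A at *
    generalize poch (c - a + k) (n + 1) = B at *
    field_simp
  have hO : ∀ k ∈ Finset.range ((n + 1) / 2),
      (n.choose (2 * k + 1) : ℂ) *
          ((-1 : ℂ) ^ k * (c + (k : ℂ)) * poch (1 - a) (2 * k + 1) * poch (c - a) (k + 1)) /
          (poch (1 - c - (n : ℂ)) (k + 1) * poch (c - a + (n : ℂ)) (k + 1) *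
            poch c (k + 1)) =
      - (poch (c - a) n / poch c n * tO (c - a) (1 - a) n k) := by
    intro k hkr
    rw [Finset.mem_range] at hkr
    obtain ⟨j, hj⟩ : ∃ j, n = k + j + (k + 1) := ⟨n - (2 * k + 1), by omega⟩
    have e1 : poch (1 - c - (n : ℂ)) (k + 1) =
        (-1) ^ (k + 1) * poch (c + (k + j : ℕ)) (k + 1) := by
      rw [sub_sub, poch_reflect, hj]; push_cast
      rw [show c + (k + j + (k + 1)) - ((k : ℂ) + 1) = c + (k + j) by ring]
    have e2 : poch c n = poch c k * poch (c + k) j * poch (c + (k + j : ℕ)) (k + 1) := by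
      rw [hj, poch_add, poch_add]
    have e3 : poch (c - a) (k + 1) * poch (c - a + k + 1) n =
        poch (c - a) n * poch (c - a + n) (k + 1) := by
      rw [← poch_add, add_assoc, show (k : ℂ) + 1 = (k + 1 : ℕ) by push_cast; rfl, ← poch_add]
      congr 1; omega
    rw [e2] at hcn0
    have n1 := left_ne_zero_of_mul (left_ne_zero_of_mul hcn0)
    have n2 := right_ne_zero_of_mul (left_ne_zero_of_mul hcn0)
    have n3 := right_ne_zero_of_mul hcn0
    have n4 : poch (c - a + k + 1) n ≠ 0 := by
      have := hk (k + 1) n; push_cast at this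
      rwa [add_assoc]
    have n5 := hk n (k + 1)
    have n7 := hc k (by omega)
    unfold tO
    rw [e1, e2, show n - (2 * k + 1) = j by omega,
      show c - a + 1 - (1 - a) + (k : ℂ) = c + k by ring, poch_succ c k]
    have n6 : ((-1 : ℂ)) ^ k ≠ 0 := by simp
    have e3' : poch (c - a) (k + 1) = poch (c - a) n * poch (c - a + n) (k + 1) /
      poch (c - a + k + 1) n := by rw [← e3]; field_simp
    rw [e3', pow_succ]
    generalize poch (c - a + n) (k + 1) = A at *
    generalize poch (c - a + k + 1) n = B at *
    generalize poch (c + (k + j : ℕ)) (k + 1) = D at *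
    field_simp
  rw [Finset.sum_congr rfl hE, Finset.sum_congr rfl hO, Finset.sum_neg_distrib, sub_neg_eq_add]
  have hext : ∑ k ∈ Finset.range ((n + 1) / 2), poch (c - a) n / poch c n * tO (c - a) (1 - a) n k =
      ∑ k ∈ Finset.range (n / 2 + 1), poch (c - a) n / poch c n * tO (c - a) (1 - a) n k := by
    apply Finset.sum_subset
    · intro k; simp only [Finset.mem_range]; omega
    · intro k _ h2
      rw [Finset.mem_range] at h2
      unfold tO
      rw [Nat.choose_eq_zero_of_lt (show n < 2 * k + 1 by omega)]
      simp
  rw [hext, ← Finset.mul_sum, ← Finset.mul_sum, ← mul_add, ← Finset.sum_add_distrib,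
    total_sum _ _ hb _ _ (by omega), mul_one]

theorem dense_generic (c : ℂ) : Dense {a : ℂ | ∀ j : ℕ, c - a + (j : ℂ) ≠ 0} := by
  have h : (Set.range fun j : ℕ => c + (j : ℂ)).Countable := Set.countable_range _
  refine (h.dense_compl ℝ).mono ?_
  intro a ha j hj
  exact ha ⟨j, by simp only; linear_combination hj⟩

/-- Fourth-type reciprocal relation dual to the Chu–Vandermonde–Gauß summation formula,
second form. -/
theorem cvg_reciprocal_fourth_second (n : ℕ) (a c : ℂ)
    (hc : ∀ j : ℕ, j < n → c + (j : ℂ) ≠ 0)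
    (hcn : ∀ j : ℕ, j ≤ n / 2 → 1 - c - (n : ℂ) + (j : ℂ) ≠ 0)
    (hca : ∀ j : ℕ, j ≤ n / 2 → c - a + (n : ℂ) + (j : ℂ) ≠ 0) :
    poch (c - a) n / poch c n =
      (∑ k ∈ Finset.range (n / 2 + 1),
        (n.choose (2 * k) : ℂ) *
          ((-1 : ℂ) ^ k * (c - a + 3 * (k : ℂ)) * poch (1 - a) (2 * k) * poch (c - a) k) /
          (poch (1 - c - (n : ℂ)) k * poch (c - a + (n : ℂ)) (k + 1) * poch c k)) -
      ∑ k ∈ Finset.range ((n + 1) / 2),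
        (n.choose (2 * k + 1) : ℂ) *
          ((-1 : ℂ) ^ k * (c + (k : ℂ)) * poch (1 - a) (2 * k + 1) * poch (c - a) (k + 1)) /
          (poch (1 - c - (n : ℂ)) (k + 1) * poch (c - a + (n : ℂ)) (k + 1) *
            poch c (k + 1)) := by
  have hpc : ∀ m : ℕ, Continuous fun x : ℂ => poch x m := poch_continuous
  have hcomp : ∀ (m : ℕ) (f : ℂ → ℂ), Continuous f → Continuous fun x => poch (f x) m :=
    fun m f hf => (hpc m).comp hf
  have hA : ∀ m, Continuous fun z : ℂ => poch (c - z) m := fun m => hcomp m _ (by fun_prop)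
  have hB : ∀ m, Continuous fun z : ℂ => poch (1 - z) m := fun m => hcomp m _ (by fun_prop)
  have hD : ∀ m, Continuous fun z : ℂ => poch (c - z + (n : ℂ)) m :=
    fun m => hcomp m _ (by fun_prop)
  have hne := mem_closure_iff_nhdsWithin_neBot.mp ((dense_generic c) a)
  refine tendsto_nhds_unique_of_eventuallyEq
    (l := nhdsWithin a {a : ℂ | ∀ j : ℕ, c - a + (j : ℂ) ≠ 0})
    (f := fun z : ℂ => poch (c - z) n / poch c n)
    (g := fun z : ℂ => (∑ k ∈ Finset.range (n / 2 + 1),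
        (n.choose (2 * k) : ℂ) *
          ((-1 : ℂ) ^ k * (c - z + 3 * (k : ℂ)) * poch (1 - z) (2 * k) * poch (c - z) k) /
          (poch (1 - c - (n : ℂ)) k * poch (c - z + (n : ℂ)) (k + 1) * poch c k)) -
      ∑ k ∈ Finset.range ((n + 1) / 2),
        (n.choose (2 * k + 1) : ℂ) *
          ((-1 : ℂ) ^ k * (c + (k : ℂ)) * poch (1 - z) (2 * k + 1) * poch (c - z) (k + 1)) /
          (poch (1 - c - (n : ℂ)) (k + 1) * poch (c - z + (n : ℂ)) (k + 1) *
            poch c (k + 1))) ?_ ?_ ?_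
  · exact (((hA n).div_const _).tendsto a).mono_left nhdsWithin_le_nhds
  · refine Filter.Tendsto.mono_left ?_ nhdsWithin_le_nhds
    refine Filter.Tendsto.sub (tendsto_finsetSum _ fun k hk => ?_)
      (tendsto_finsetSum _ fun k hk => ?_)
    · rw [Finset.mem_range] at hk
      refine Filter.Tendsto.div (Continuous.tendsto (by fun_prop) a)
        (Continuous.tendsto (by fun_prop) a) ?_
      refine mul_ne_zero (mul_ne_zero ?_ ?_) ?_
      · exact poch_ne_zero _ _ fun j hj => hcn j (by omega)
      · exact poch_ne_zero _ _ fun j hj => hca j (by omega)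
      · exact poch_ne_zero _ _ fun j hj => hc j (by omega)
    · rw [Finset.mem_range] at hk
      refine Filter.Tendsto.div (Continuous.tendsto (by fun_prop) a)
        (Continuous.tendsto (by fun_prop) a) ?_
      refine mul_ne_zero (mul_ne_zero ?_ ?_) ?_
      · exact poch_ne_zero _ _ fun j hj => hcn j (by omega)
      · exact poch_ne_zero _ _ fun j hj => hca j (by omega)
      · exact poch_ne_zero _ _ fun j hj => hc j (by omega)
  · filter_upwards [self_mem_nhdsWithin] with z hz
    exact generic_case n z c hc hz
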